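/- arXiv:1110.2078 — 4 statements merged into one kernel-verified Lean document; each statement's English description precedes it below -/
import Mathlib

section
/- Let (N, [·,...,·], α, B) be a quadratic multiplicative n-ary Hom-Nambu algebra. Then (N, α^{n-1}∘[·,...,·], α^n, B, α^{n-1}) is a Hom-quadratic Hom-Nambu algebra, and (N, α^{n-1}∘[·,...,·], α^n, B_α), where B_α(x,y) = B(α^{n-1}(x),y) = B(x,α^{n-1}(y)), is a quadratic Hom-Nambu algebra: B_α is symmetric, B_α(α^{n-1}∘[x_1,...,x_{n-1},y], z) + B_α(y, α^{n-1}∘[x_1,...,x_{n-1},z]) = 0, and B_α(α^{n-1}(y),z) = B_α(y,α^{n-1}(z)). -/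
/-- The Hom-Nambu identity for an `(m+1)`-ary bracket `br` with twist maps
`α : Fin m → (N →ₗ[K] N)`. -/
def HomNambu {K : Type*} [Field K] {N : Type*} [AddCommGroup N] [Module K N] {m : ℕ}
    (br : (Fin (m + 1) → N) → N) (α : Fin m → (N →ₗ[K] N)) : Prop :=
  ∀ (x : Fin m → N) (y : Fin (m + 1) → N),
    br (Fin.snoc (fun i => α i (x i)) (br y)) =
      ∑ i : Fin (m + 1), br (fun j =>
        if h : (j : ℕ) < (i : ℕ) then α ⟨(j : ℕ), by have := i.2; omega⟩ (y j)
        else if h' : (j : ℕ) = (i : ℕ) then br (Fin.snoc x (y i))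
        else α ⟨(j : ℕ) - 1, by have := j.2; omega⟩ (y j))

section TwistLemmas

variable {K : Type*} [Field K] {N : Type*} [AddCommGroup N] [Module K N] {m : ℕ}

/-- Powers of a multiplicative twist are multiplicative. -/
theorem pow_apply_bracket {br : (Fin (m + 1) → N) → N} {α : N →ₗ[K] N}
    (hmult : ∀ x, α (br x) = br (fun i => α (x i))) (k : ℕ) (x : Fin (m + 1) → N) :
    (α ^ k) (br x) = br (fun i => (α ^ k) (x i)) := by
  induction k with
  | zero => simp
  | succ k ih => simp only [pow_succ', Module.End.mul_apply, ih, hmult]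

/-- A multiplicative linear map applied to a bracket whose last entry is singled out. -/
theorem apply_bracket_snoc {br : (Fin (m + 1) → N) → N} {β : N →ₗ[K] N}
    (hmult : ∀ x, β (br x) = br (fun i => β (x i))) (x : Fin m → N) (y : N) :
    β (br (Fin.snoc x y)) = br (Fin.snoc (fun i => β (x i)) (β y)) := by
  rw [hmult]
  exact congrArg br (Fin.comp_snoc β x y)

/-- Composing the bracket of a Hom-Nambu algebra with a multiplicative map `β`
yields a Hom-Nambu algebra with twists `β ∘ α i`. -/
theorem HomNambu.twist {br : (Fin (m + 1) → N) → N} {α : Fin m → (N →ₗ[K] N)}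
    (h : HomNambu br α) {β : N →ₗ[K] N}
    (hmult : ∀ x, β (br x) = br (fun i => β (x i))) :
    HomNambu (fun x => β (br x)) (fun i => β * α i) := by
  intro x y
  have key := congrArg (fun v => β (β v)) (h x y)
  simp only [apply_bracket_snoc hmult (fun i => α i (x i)), map_sum] at key
  refine key.trans (Finset.sum_congr rfl fun i _ => congrArg β ?_)
  rw [hmult]
  congr 1
  funext j
  split_ifs <;> rfl

/-- Powers of a self-adjoint map are self-adjoint. -/
theorem bilin_pow_apply_left {B : N →ₗ[K] N →ₗ[K] K} {α : N →ₗ[K] N}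
    (hBα : ∀ x y, B (α x) y = B x (α y)) (k : ℕ) (x y : N) :
    B ((α ^ k) x) y = B x ((α ^ k) y) := by
  induction k generalizing x y with
  | zero => simp
  | succ k ih =>
    rw [pow_succ, Module.End.mul_apply, ih, hBα, ← Module.End.mul_apply, (Commute.self_pow α k).eq]

end TwistLemmas

/-- Let `(N, br, α, B)` be a quadratic multiplicative `n`-ary Hom-Nambu
algebra (`n = m+1`).  Then `(N, α^{n-1}∘br, αⁿ, B, α^{n-1})` is a Hom-quadratic Hom-Nambu
algebra, and `(N, α^{n-1}∘br, αⁿ, B_α)` with `B_α(x,y) = B(α^{n-1}(x),y)` is a quadratic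
Hom-Nambu algebra. -/
theorem second_twist_quadratic_homNambu
    {K : Type*} [Field K] [CharZero K] {N : Type*} [AddCommGroup N] [Module K N]
    {m : ℕ} (hm : 1 ≤ m)
    (br : MultilinearMap K (fun _ : Fin (m + 1) => N) N)
    (α : N →ₗ[K] N)
    (hNambu : HomNambu (K := K) (⇑br) (fun _ => α))
    (hmult : ∀ x : Fin (m + 1) → N, α (br x) = br (fun i => α (x i)))
    (B : N →ₗ[K] N →ₗ[K] K)
    (hBsymm : ∀ x y : N, B x y = B y x)
    (hBnondeg : ∀ x : N, (∀ y : N, B x y = 0) → x = 0)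
    (hBα : ∀ x y : N, B (α x) y = B x (α y))
    (hBinv : ∀ (x : Fin m → N) (y z : N),
      B (br (Fin.snoc x y)) z + B y (br (Fin.snoc x z)) = 0) :
    -- `(N, α^{n-1}∘br, αⁿ)` is a Hom-Nambu algebra and is Hom-quadratic for `(B, α^{n-1})`:
    (HomNambu (K := K) (fun x => (α ^ m) (br x)) (fun _ => α ^ (m + 1)) ∧
      ∀ (x : Fin m → N) (y z : N),
        B ((α ^ m) (br (Fin.snoc x y))) ((α ^ m) z) +
          B ((α ^ m) y) ((α ^ m) (br (Fin.snoc x z))) = 0) ∧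
    -- `B_α(x,y) = B(α^{n-1}(x),y) = B(x,α^{n-1}(y))` makes it quadratic:
    ((∀ x y : N, B ((α ^ m) x) y = B x ((α ^ m) y)) ∧
      (∀ x y : N, B ((α ^ m) x) y = B ((α ^ m) y) x) ∧
      (∀ (x : Fin m → N) (y z : N),
        B ((α ^ m) ((α ^ m) (br (Fin.snoc x y)))) z +
          B ((α ^ m) y) ((α ^ m) (br (Fin.snoc x z))) = 0) ∧
      (∀ y z : N, B ((α ^ m) ((α ^ m) y)) z = B ((α ^ m) y) ((α ^ m) z))) := by
  have hpow := pow_apply_bracket hmult m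
  have hadj := bilin_pow_apply_left hBα m
  have hinv : ∀ (x : Fin m → N) (y z : N),
      B ((α ^ m) (br (Fin.snoc x y))) ((α ^ m) z) +
        B ((α ^ m) y) ((α ^ m) (br (Fin.snoc x z))) = 0 := fun x y z => by
    rw [apply_bracket_snoc hpow, apply_bracket_snoc hpow]
    exact hBinv _ _ _
  refine ⟨⟨?_, hinv⟩, hadj, fun x y => (hadj x y).trans (hBsymm _ _), fun x y z => ?_,
    fun y z => hadj _ _⟩
  · simpa only [pow_succ] using hNambu.twist hpow
  · rw [hadj]
    exact hinv x y z
end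

section
/- Let (N, [·,...,·]_N, B) be a quadratic n-ary Nambu-Lie algebra and α ∈ Aut_S(N,B) an involution (α is an algebra automorphism with α² = id and B(α(x),y) = B(x,α(y))). Let L = N ⊕ N* with the T*-extension bracket [u_1,...,u_n]_L and form B_L. Define Ω: L → L by Ω(x+f) = α(x) + f∘α and [·,...,·]_Ω = Ω∘[·,...,·]_L. Then Ω([u_1,...,u_n]_L) = [Ω(u_1),...,Ω(u_n)]_L, Ω is symmetric with respect to B_L, and (L, [·,...,·]_Ω, (Ω,...,Ω), B_L, Ω) is a Hom-quadratic multiplicative n-ary Hom-Nambu algebra. -/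
/-- The `T*`-extension bracket on `L = N ⊕ N*`. -/
def tStarBracket {K : Type*} [Field K] {N : Type*} [AddCommGroup N] [Module K N] {m : ℕ}
    (br : MultilinearMap K (fun _ : Fin (m + 1) => N) N)
    (u : Fin (m + 1) → N × Module.Dual K N) : N × Module.Dual K N :=
  (br (fun i => (u i).1),
    ∑ i : Fin (m + 1), ((-1 : K) ^ ((i : ℕ) + m + 1)) •
      ((u i).2 ∘ₗ (br.curryRight (i.removeNth (fun j => (u j).1)))))

/-- The bilinear form `B_L(x+f, y+g) = B(x,y) + f(y) + g(x)` on `L = N ⊕ N*`. -/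
def tStarForm {K : Type*} [Field K] {N : Type*} [AddCommGroup N] [Module K N]
    (B : N →ₗ[K] N →ₗ[K] K)
    (u v : N × Module.Dual K N) : K :=
  B u.1 v.1 + u.2 v.1 + v.2 u.1

/-- The twist `Ω(x+f) = α(x) + f∘α` on `L = N ⊕ N*`. -/
def tStarTwist {K : Type*} [Field K] {N : Type*} [AddCommGroup N] [Module K N]
    (α : N →ₗ[K] N) : N × Module.Dual K N →ₗ[K] N × Module.Dual K N :=
  LinearMap.prodMap α (LinearMap.dualMap α)

open Function Finset

section TStarExtension

variable {K : Type*} [Field K] {N : Type*} [AddCommGroup N] [Module K N] {m : ℕ}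

/-- With all twist maps equal, the Hom-Nambu identity says that the bracket by `x` acts as a
twisted derivation, each summand replacing one entry of `y`. -/
theorem homNambu_const_iff (br : (Fin (m + 1) → N) → N) (β : N →ₗ[K] N) :
    HomNambu br (fun _ => β) ↔ ∀ (x : Fin m → N) (y : Fin (m + 1) → N),
      br (Fin.snoc (fun i => β (x i)) (br y)) =
        ∑ i, br (update (fun j => β (y j)) i (br (Fin.snoc x (y i)))) := by
  refine forall₂_congr fun x y => ?_
  refine Eq.congr_right (sum_congr rfl fun i _ => congrArg br (funext fun j => ?_))
  rcases lt_trichotomy j i with h | rfl | h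
  · simp [h, h.ne]
  · simp
  · simp [h.not_gt, h.ne', Fin.val_inj]

/-- A bracket on `N` is skew-symmetric if permuting its arguments multiplies it by the sign. -/
def IsSkewBracket (br : MultilinearMap K (fun _ : Fin (m + 1) => N) N) : Prop :=
  ∀ (σ : Equiv.Perm (Fin (m + 1))) (x : Fin (m + 1) → N),
    br (x ∘ σ) = (Equiv.Perm.sign σ : ℤ) • br x

variable {br : MultilinearMap K (fun _ : Fin (m + 1) => N) N}

theorem Fin.snoc_removeNth_eq_update_comp_cycleIcc {α : Type*} (i : Fin (m + 1))
    (x : Fin (m + 1) → α) (v : α) :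
    (Fin.snoc (i.removeNth x) v : Fin (m + 1) → α) =
      update x i v ∘ Fin.cycleIcc i (Fin.last m) := by
  funext j
  induction j using Fin.lastCases with
  | last => simp [-Fin.cycleIcc_def_le, Fin.cycleIcc_of_last (Fin.le_last i)]
  | cast j =>
    have h := congrFun (Fin.cycleIcc_comp_succAbove i (Fin.last m) (Fin.le_last i)) j
    rw [Function.comp_apply, Fin.succAbove_last] at h
    rw [Function.comp_apply, h, Fin.snoc_castSucc, update_of_ne (Fin.succAbove_ne i j)]
    rfl

theorem IsSkewBracket.apply_snoc_removeNth (hskew : IsSkewBracket br) (i : Fin (m + 1))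
    (x : Fin (m + 1) → N) (v : N) :
    br (Fin.snoc (i.removeNth x) v) = (-1 : K) ^ (m - (i : ℕ)) • br (update x i v) := by
  rw [Fin.snoc_removeNth_eq_update_comp_cycleIcc, hskew,
    Fin.sign_cycleIcc_of_le (Fin.le_last i), ← Int.cast_smul_eq_zsmul K]
  simp

theorem IsSkewBracket.apply_snoc_update_swap (hskew : IsSkewBracket br) (x : Fin m → N)
    (k : Fin m) (a b : N) :
    br (Fin.snoc (update x k a) b) = -br (Fin.snoc (update x k b) a) := by
  have hne : k.castSucc ≠ Fin.last m := (Fin.castSucc_lt_last k).ne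
  have h := hskew (Equiv.swap k.castSucc (Fin.last m)) (Fin.snoc (update x k b) a)
  rw [Equiv.Perm.sign_swap hne] at h
  rw [show (-br (Fin.snoc (update x k b) a)) = ((-1 : ℤˣ) : ℤ) • br (Fin.snoc (update x k b) a) by
    simp, ← h]
  congr 1
  funext j
  induction j using Fin.lastCases with
  | last => simp
  | cast j =>
    rcases eq_or_ne j k with rfl | hj
    · simp [-Fin.snoc_update]
    · rw [Function.comp_apply, Equiv.swap_apply_of_ne_of_ne (by simpa using hj)
        (Fin.castSucc_lt_last j).ne]
      simp [hj]

/-- The invariance of `B` holds in every argument slot of a skew-symmetric bracket. -/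
theorem IsSkewBracket.form_apply_update (hskew : IsSkewBracket br) {B : N →ₗ[K] N →ₗ[K] K}
    (hBinv : ∀ (x : Fin m → N) (y z : N),
      B (br (Fin.snoc x y)) z + B y (br (Fin.snoc x z)) = 0)
    (x : Fin (m + 1) → N) (i : Fin (m + 1)) (w v : N) :
    B w (br (update x i v)) = -B (br (update x i w)) v := by
  have h := hBinv (i.removeNth x) w v
  rw [hskew.apply_snoc_removeNth, hskew.apply_snoc_removeNth] at h
  simp only [map_smul, LinearMap.smul_apply, ← smul_add] at h
  rw [smul_eq_zero_iff_right (pow_ne_zero _ (by simp))] at h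
  exact eq_neg_of_add_eq_zero_right h

theorem IsSkewBracket.form_apply_snoc_update (hskew : IsSkewBracket br)
    {B : N →ₗ[K] N →ₗ[K] K}
    (hBinv : ∀ (x : Fin m → N) (y z : N),
      B (br (Fin.snoc x y)) z + B y (br (Fin.snoc x z)) = 0)
    (x : Fin m → N) (k : Fin m) (y w v : N) :
    B w (br (Fin.snoc (update x k v) y)) = -B (br (Fin.snoc (update x k w) y)) v := by
  simpa only [Fin.snoc_update] using hskew.form_apply_update hBinv (Fin.snoc x y) k.castSucc w v

/-- For a skew-symmetric bracket the signs in the `T*`-extension cancel when the new argument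
is put back into the vacated slot. -/
theorem IsSkewBracket.tStarBracket_snd_apply (hskew : IsSkewBracket br)
    (u : Fin (m + 1) → N × Module.Dual K N) (v : N) :
    (tStarBracket br u).2 v = -∑ i, (u i).2 (br (update (fun j => (u j).1) i v)) := by
  simp only [tStarBracket, LinearMap.sum_apply, LinearMap.smul_apply, LinearMap.comp_apply,
    MultilinearMap.curryRight_apply, hskew.apply_snoc_removeNth, map_smul, smul_smul,
    ← pow_add, ← sum_neg_distrib]
  refine sum_congr rfl fun i _ => ?_
  rw [show (i : ℕ) + m + 1 + (m - i) = 2 * m + 1 by omega, pow_succ, pow_mul]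
  simp

theorem IsSkewBracket.tStarBracket_snoc_snd_apply (hskew : IsSkewBracket br)
    (u : Fin m → N × Module.Dual K N) (w : N × Module.Dual K N) (v : N) :
    (tStarBracket br (Fin.snoc u w)).2 v =
      -∑ k, (u k).2 (br (Fin.snoc (update (fun j => (u j).1) k v) w.1)) -
        w.2 (br (Fin.snoc (fun j => (u j).1) v)) := by
  have hfst : (fun j => ((Fin.snoc u w : Fin (m + 1) → N × Module.Dual K N) j).1) =
      Fin.snoc (fun j => (u j).1) w.1 := Fin.comp_snoc Prod.fst u w
  rw [hskew.tStarBracket_snd_apply, hfst, Fin.sum_univ_castSucc]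
  simp only [Fin.snoc_castSucc, Fin.snoc_last, Fin.update_snoc_last, ← Fin.snoc_update]
  abel

theorem tStarBracket_snoc_fst (u : Fin m → N × Module.Dual K N) (w : N × Module.Dual K N) :
    (tStarBracket br (Fin.snoc u w)).1 = br (Fin.snoc (fun j => (u j).1) w.1) :=
  congrArg br (Fin.comp_snoc Prod.fst u w)

theorem tStarTwist_tStarTwist {α : N →ₗ[K] N} (hαinv : α ∘ₗ α = LinearMap.id)
    (u : N × Module.Dual K N) : tStarTwist α (tStarTwist α u) = u := by
  have hα : ∀ x, α (α x) = x := LinearMap.congr_fun hαinv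
  ext <;> simp [tStarTwist, hα]

theorem tStarForm_tStarTwist {B : N →ₗ[K] N →ₗ[K] K} {α : N →ₗ[K] N}
    (hαB : ∀ x y : N, B (α x) y = B x (α y)) (u v : N × Module.Dual K N) :
    tStarForm B (tStarTwist α u) v = tStarForm B u (tStarTwist α v) := by
  simp [tStarForm, tStarTwist, hαB]

theorem IsSkewBracket.tStarTwist_tStarBracket (hskew : IsSkewBracket br) {α : N →ₗ[K] N}
    (hαalg : ∀ x : Fin (m + 1) → N, α (br x) = br (fun i => α (x i)))
    (hαinv : α ∘ₗ α = LinearMap.id) (u : Fin (m + 1) → N × Module.Dual K N) :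
    tStarTwist α (tStarBracket br u) = tStarBracket br (fun i => tStarTwist α (u i)) := by
  have hα : ∀ x, α (α x) = x := LinearMap.congr_fun hαinv
  refine Prod.ext (hαalg _) (LinearMap.ext fun v => ?_)
  rw [hskew.tStarBracket_snd_apply]
  change (tStarBracket br u).2 (α v) = _
  rw [hskew.tStarBracket_snd_apply]
  refine congrArg Neg.neg (sum_congr rfl fun i _ => ?_)
  change _ = (u i).2 (α (br (update (fun j => α (u j).1) i v)))
  rw [hαalg]
  refine congrArg (fun z => (u i).2 (br z)) (funext fun j => ?_)
  rcases eq_or_ne j i with rfl | hj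
  · simp
  · simp [hj, hα]

/-- The transpose, with respect to an invariant nondegenerate form, of the Nambu identity. -/
theorem IsSkewBracket.nambu_transpose (hskew : IsSkewBracket br)
    (hNambu : HomNambu (K := K) (⇑br) (fun _ => LinearMap.id)) {B : N →ₗ[K] N →ₗ[K] K}
    (hBsymm : ∀ x y : N, B x y = B y x)
    (hBnondeg : ∀ x : N, (∀ y : N, B x y = 0) → x = 0)
    (hBinv : ∀ (x : Fin m → N) (y z : N),
      B (br (Fin.snoc x y)) z + B y (br (Fin.snoc x z)) = 0)
    (x : Fin m → N) (y : Fin (m + 1) → N) (k : Fin m) (v : N) :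
    br (Fin.snoc (update x k v) (br y)) =
      -∑ i, br (Fin.snoc (update x k (br (update y i v))) (y i)) := by
  rw [eq_neg_iff_add_eq_zero]
  refine hBnondeg _ fun w => ?_
  have hN : br (Fin.snoc (update x k w) (br y)) =
      ∑ i, br (update y i (br (Fin.snoc (update x k w) (y i)))) :=
    (homNambu_const_iff _ _).1 hNambu (update x k w) y
  rw [hBsymm, map_add, map_sum, hskew.form_apply_snoc_update hBinv, hN, map_sum, LinearMap.sum_apply, ← sum_neg_distrib, ← sum_add_distrib]
  refine sum_eq_zero fun i _ => ?_
  rw [hskew.form_apply_snoc_update hBinv, hskew.form_apply_update hBinv y, neg_neg,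
    neg_add_cancel]

/-- The `T*`-extension of a quadratic Nambu-Lie algebra satisfies the Nambu identity. -/
theorem IsSkewBracket.tStarBracket_nambu (hskew : IsSkewBracket br)
    (hNambu : HomNambu (K := K) (⇑br) (fun _ => LinearMap.id)) {B : N →ₗ[K] N →ₗ[K] K}
    (hBsymm : ∀ x y : N, B x y = B y x)
    (hBnondeg : ∀ x : N, (∀ y : N, B x y = 0) → x = 0)
    (hBinv : ∀ (x : Fin m → N) (y z : N),
      B (br (Fin.snoc x y)) z + B y (br (Fin.snoc x z)) = 0)
    (X : Fin m → N × Module.Dual K N) (Y : Fin (m + 1) → N × Module.Dual K N) :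
    tStarBracket br (Fin.snoc X (tStarBracket br Y)) =
      ∑ i, tStarBracket br (update Y i (tStarBracket br (Fin.snoc X (Y i)))) := by
  have hN : ∀ (x : Fin m → N) (y : Fin (m + 1) → N), br (Fin.snoc x (br y)) =
      ∑ i, br (update y i (br (Fin.snoc x (y i)))) := (homNambu_const_iff _ _).1 hNambu
  set x : Fin m → N := fun j => (X j).1
  set y : Fin (m + 1) → N := fun j => (Y j).1
  have hfst : ∀ i, (fun j => (update Y i (tStarBracket br (Fin.snoc X (Y i))) j).1) =
      update y i (br (Fin.snoc x (y i))) := fun i => by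
    rw [← tStarBracket_snoc_fst]
    exact Function.comp_update Prod.fst Y i _
  refine Prod.ext ?_ (LinearMap.ext fun v => ?_)
  · rw [tStarBracket_snoc_fst, Prod.fst_sum]
    exact (hN x y).trans (sum_congr rfl fun i _ => congrArg br (hfst i).symm)
  -- the summand of the right-hand side, separating the slot holding the inner bracket
  have hterm : ∀ i, (tStarBracket br (update Y i (tStarBracket br (Fin.snoc X (Y i))))).2 v =
      (∑ k, (X k).2 (br (Fin.snoc (update x k (br (update y i v))) (y i)))
        + (Y i).2 (br (Fin.snoc x (br (update y i v)))))
      - ∑ j ∈ univ.erase i, (Y j).2 (br (update (update y i (br (Fin.snoc x (y i)))) j v)) := by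
    intro i
    rw [hskew.tStarBracket_snd_apply, hfst, ← add_sum_erase _ _ (mem_univ i), update_self,
      update_idem, hskew.tStarBracket_snoc_snd_apply,
      sum_congr (s₁ := univ.erase i) rfl fun j hj => by rw [update_of_ne (ne_of_mem_erase hj)]]
    change -(-∑ k, (X k).2 (br (Fin.snoc (update x k (br (update y i v))) (y i))) -
      (Y i).2 (br (Fin.snoc x (br (update y i v)))) + _) = _
    abel
  -- the coefficient of each functional carried by `Y`
  have hY : ∀ j, (Y j).2 (br (update y j (br (Fin.snoc x v)))) =
      (Y j).2 (br (Fin.snoc x (br (update y j v)))) -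
        ∑ i ∈ univ.erase j, (Y j).2 (br (update (update y i (br (Fin.snoc x (y i)))) j v)) := by
    intro j
    rw [hN x (update y j v), ← add_sum_erase _ _ (mem_univ j), update_self, update_idem, map_add,
      map_sum, sum_congr rfl fun i hi => by
        rw [update_of_ne (ne_of_mem_erase hi), update_comm (ne_of_mem_erase hi).symm]]
    abel
  have hswap : ∑ i, ∑ j ∈ univ.erase i,
        (Y j).2 (br (update (update y i (br (Fin.snoc x (y i)))) j v)) =
      ∑ j, ∑ i ∈ univ.erase j,
        (Y j).2 (br (update (update y i (br (Fin.snoc x (y i)))) j v)) :=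
    sum_comm' fun i j => by simp [eq_comm]
  rw [Prod.snd_sum, LinearMap.sum_apply, sum_congr rfl fun i _ => hterm i, sum_sub_distrib,
    sum_add_distrib, hswap, add_sub_assoc, ← sum_sub_distrib, ← sum_congr rfl fun j _ => hY j,
    hskew.tStarBracket_snoc_snd_apply, hskew.tStarBracket_snd_apply, sub_neg_eq_add, sum_comm,
    ← sum_neg_distrib]
  refine congrArg (· + _) (sum_congr rfl fun k _ => ?_)
  change -(X k).2 (br (Fin.snoc (update x k v) (br y))) = _
  rw [hskew.nambu_transpose hNambu hBsymm hBnondeg hBinv, map_neg, map_sum, neg_neg]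

/-- The form `B_L` is invariant under the `T*`-extension bracket. -/
theorem IsSkewBracket.tStarForm_invariant (hskew : IsSkewBracket br) {B : N →ₗ[K] N →ₗ[K] K}
    (hBinv : ∀ (x : Fin m → N) (y z : N),
      B (br (Fin.snoc x y)) z + B y (br (Fin.snoc x z)) = 0)
    (u : Fin m → N × Module.Dual K N) (v w : N × Module.Dual K N) :
    tStarForm B (tStarBracket br (Fin.snoc u v)) w +
      tStarForm B v (tStarBracket br (Fin.snoc u w)) = 0 := by
  have hswap : ∑ k, (u k).2 (br (Fin.snoc (update (fun j => (u j).1) k w.1) v.1)) =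
      -∑ k, (u k).2 (br (Fin.snoc (update (fun j => (u j).1) k v.1) w.1)) := by
    rw [← sum_neg_distrib]
    exact sum_congr rfl fun k _ => by rw [hskew.apply_snoc_update_swap, map_neg]
  simp only [tStarForm, tStarBracket_snoc_fst, hskew.tStarBracket_snoc_snd_apply, hswap]
  linear_combination hBinv (fun j => (u j).1) v.1 w.1

end TStarExtension

/-- Let `(N, br, B)` be a quadratic `n`-ary Nambu-Lie algebra and
`α ∈ Aut_S(N,B)` an involution.  On the `T*`-extension `L = N ⊕ N*` the map
`Ω(x+f) = α(x)+f∘α` is multiplicative for `[·,…,·]_L`, symmetric for `B_L`, and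
`(L, Ω∘[·,…,·]_L, (Ω,…,Ω), B_L, Ω)` is a Hom-quadratic multiplicative `n`-ary
Hom-Nambu algebra. -/
theorem tStar_extension_hom_quadratic
    {K : Type*} [Field K] [CharZero K] {N : Type*} [AddCommGroup N] [Module K N]
    {m : ℕ} (hm : 1 ≤ m)
    (br : MultilinearMap K (fun _ : Fin (m + 1) => N) N)
    (hNambu : HomNambu (K := K) (⇑br) (fun _ => LinearMap.id))
    (hskew : ∀ (σ : Equiv.Perm (Fin (m + 1))) (x : Fin (m + 1) → N),
      br (x ∘ σ) = (Equiv.Perm.sign σ : ℤ) • br x)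
    (B : N →ₗ[K] N →ₗ[K] K)
    (hBsymm : ∀ x y : N, B x y = B y x)
    (hBnondeg : ∀ x : N, (∀ y : N, B x y = 0) → x = 0)
    (hBinv : ∀ (x : Fin m → N) (y z : N),
      B (br (Fin.snoc x y)) z + B y (br (Fin.snoc x z)) = 0)
    (α : N →ₗ[K] N)
    (hαalg : ∀ x : Fin (m + 1) → N, α (br x) = br (fun i => α (x i)))
    (hαinv : α ∘ₗ α = LinearMap.id)
    (hαB : ∀ x y : N, B (α x) y = B x (α y)) :
    -- `Ω` is an endomorphism of the bracket `[·,…,·]_L`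
    (∀ u : Fin (m + 1) → N × Module.Dual K N,
      tStarTwist α (tStarBracket br u) = tStarBracket br (fun i => tStarTwist α (u i))) ∧
    -- `Ω` is symmetric with respect to `B_L`
    (∀ u v : N × Module.Dual K N,
      tStarForm B (tStarTwist α u) v = tStarForm B u (tStarTwist α v)) ∧
    -- `(L, Ω∘[·,…,·]_L, (Ω,…,Ω))` satisfies the Hom-Nambu identity
    HomNambu (K := K) (fun u => tStarTwist α (tStarBracket br u)) (fun _ => tStarTwist α) ∧
    -- multiplicativity of `Ω` for the twisted bracket
    (∀ u : Fin (m + 1) → N × Module.Dual K N,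
      tStarTwist α (tStarTwist α (tStarBracket br u)) =
        tStarTwist α (tStarBracket br (fun i => tStarTwist α (u i)))) ∧
    -- `Ω`-invariance of `B_L` for the twisted bracket
    (∀ (u : Fin m → N × Module.Dual K N) (v w : N × Module.Dual K N),
      tStarForm B (tStarTwist α (tStarBracket br (Fin.snoc u v))) (tStarTwist α w) +
        tStarForm B (tStarTwist α v) (tStarTwist α (tStarBracket br (Fin.snoc u w))) = 0) := by
  have hskew' : IsSkewBracket br := hskew
  have hΩ := hskew'.tStarTwist_tStarBracket hαalg hαinv
  refine ⟨hΩ, tStarForm_tStarTwist hαB, ?_, fun u => congrArg _ (hΩ u), fun u v w => ?_⟩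
  · rw [homNambu_const_iff]
    intro X Y
    have hsnoc : (Fin.snoc (fun i => tStarTwist α (X i)) (tStarTwist α (tStarBracket br Y)) :
        Fin (m + 1) → N × Module.Dual K N) =
        fun i => tStarTwist α ((Fin.snoc X (tStarBracket br Y) :
          Fin (m + 1) → N × Module.Dual K N) i) :=
      (Fin.comp_snoc (tStarTwist α) X (tStarBracket br Y)).symm
    have hupdate : ∀ i w, update (fun j => tStarTwist α (Y j)) i (tStarTwist α w) =
        fun j => tStarTwist α (update Y i w j) :=
      fun i w => (Function.comp_update (tStarTwist α) Y i w).symm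
    simp only [hsnoc, hupdate, ← hΩ, tStarTwist_tStarTwist hαinv]
    exact hskew'.tStarBracket_nambu hNambu hBsymm hBnondeg hBinv X Y
  · rw [tStarForm_tStarTwist hαB, tStarForm_tStarTwist hαB, tStarTwist_tStarTwist hαinv,
      tStarTwist_tStarTwist hαinv]
    exact hskew'.tStarForm_invariant hBinv u v w
end

section
/- Let (A, μ, (η_1,...,η_{n-1}), B_A, β_A) be a Hom-quadratic symmetric n-ary totally Hom-associative algebra, i.e. B_A is a symmetric nondegenerate bilinear form with B_A(η_i(a),b) = B_A(a,η_i(b)) for all i and B_A(μ(a_1,...,a_{n-1},b), β_A(c)) = B_A(β_A(b), μ(a_1,...,a_{n-1},c)). Let (N, [·,...,·]_N, (α_1,...,α_{n-1}), B_N, β_N) be a Hom-quadratic n-ary Hom-Nambu algebra. Then (A⊗N, [·,...,·], (ζ_1,...,ζ_{n-1}), B̃, ω), where [a_1⊗x_1,...,a_n⊗x_n] = μ(a_1,...,a_n)⊗[x_1,...,x_n]_N, ζ_i = η_i⊗α_i, B̃(a⊗x, b⊗y) = B_A(a,b)·B_N(x,y), and ω(a⊗x) = β_A(a)⊗β_N(x),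 is a Hom-quadratic n-ary Hom-Nambu algebra. -/
open scoped TensorProduct

/-- The `k`-th expression in the total Hom-associativity chain for an `(m+1)`-ary
symmetric product `μ` with twist maps `η`. -/
def assocExpr {K : Type*} [Field K] {A : Type*} [AddCommGroup A] [Module K A] {m : ℕ}
    (μ : (Fin (m + 1) → A) → A) (η : Fin m → (A →ₗ[K] A))
    (a : Fin (2 * m + 1) → A) (k : Fin (m + 1)) : A :=
  μ (fun j =>
    if h : (j : ℕ) < (k : ℕ) then
      η ⟨(j : ℕ), by have := k.2; omega⟩ (a ⟨(j : ℕ), by have := j.2; omega⟩)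
    else if h' : (j : ℕ) = (k : ℕ) then
      μ (fun l => a ⟨(k : ℕ) + (l : ℕ), by have := k.2; have := l.2; omega⟩)
    else
      η ⟨(j : ℕ) - 1, by have := j.2; omega⟩ (a ⟨(j : ℕ) + m, by have := j.2; omega⟩))

/-- Multilinear maps on `A ⊗ N` that agree on families of pure tensors are equal. -/
theorem MultilinearMap.ext_tmul {K ι A N V : Type*} [Finite ι] [Field K]
    [AddCommGroup A] [Module K A] [AddCommGroup N] [Module K N] [AddCommGroup V] [Module K V]
    {f g : MultilinearMap K (fun _ : ι => A ⊗[K] N) V}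
    (h : ∀ (a : ι → A) (x : ι → N), f (fun i => a i ⊗ₜ x i) = g (fun i => a i ⊗ₜ x i)) :
    f = g := by
  refine Module.Basis.ext_multilinear
    (fun _ => (Module.Basis.ofVectorSpace K A).tensorProduct (Module.Basis.ofVectorSpace K N)) ?_
  intro v
  simpa only [Module.Basis.tensorProduct_apply'] using h _ _

theorem Fin.snoc_tmul {K A N : Type*} [Field K] [AddCommGroup A] [Module K A]
    [AddCommGroup N] [Module K N] {m : ℕ} (a : Fin m → A) (x : Fin m → N) (b : A) (y : N) :
    (Fin.snoc (fun i => a i ⊗ₜ[K] x i) (b ⊗ₜ[K] y) : Fin (m + 1) → A ⊗[K] N) =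
      fun i => (Fin.snoc a b : Fin (m + 1) → A) i ⊗ₜ[K] (Fin.snoc x y : Fin (m + 1) → N) i := by
  funext i
  cases i using Fin.lastCases <;> simp

/-- The tensor product of two left-separating bilinear forms over a field is left-separating. -/
theorem TensorProduct.eq_zero_of_forall_bilin_tmul_eq_zero {K A N : Type*} [Field K]
    [AddCommGroup A] [Module K A] [AddCommGroup N] [Module K N]
    {BA : A →ₗ[K] A →ₗ[K] K} {BN : N →ₗ[K] N →ₗ[K] K}
    (hA : ∀ a : A, (∀ b : A, BA a b = 0) → a = 0)
    (hN : ∀ x : N, (∀ y : N, BN x y = 0) → x = 0)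
    {Bt : (A ⊗[K] N) →ₗ[K] (A ⊗[K] N) →ₗ[K] K}
    (hBt : ∀ (a b : A) (x y : N), Bt (a ⊗ₜ[K] x) (b ⊗ₜ[K] y) = BA a b * BN x y)
    (t : A ⊗[K] N) (ht : ∀ s, Bt t s = 0) : t = 0 := by
  classical
  let e := Module.Basis.ofVectorSpace K N
  have contract (b : A) : TensorProduct.lid K N ((BA.flip b).rTensor N t) = 0 := by
    refine hN _ fun y => ?_
    rw [← ht (b ⊗ₜ y)]
    clear ht
    induction t with
    | zero => simp
    | tmul a x => simp [hBt]
    | add t s iht ihs => simp only [map_add, LinearMap.add_apply, iht, ihs]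
  apply (TensorProduct.equivFinsuppOfBasisRight e).injective
  ext i
  rw [map_zero, Finsupp.zero_apply]
  refine hA _ fun b => ?_
  have coord : BA (TensorProduct.equivFinsuppOfBasisRight e t i) b =
      e.coord i (TensorProduct.lid K N ((BA.flip b).rTensor N t)) := by
    clear ht contract
    induction t with
    | zero => simp
    | tmul a x => simp [mul_comm]
    | add t s iht ihs => simp only [map_add, Finsupp.add_apply, LinearMap.add_apply, iht, ihs]
  rw [coord, contract, map_zero]

section TotallyHomAssociative

variable {K : Type*} [Field K] {A : Type*} [AddCommGroup A] [Module K A] {m : ℕ}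
  {μ : (Fin (m + 1) → A) → A} {η : Fin m → (A →ₗ[K] A)}

/-- A swap of two adjacent arguments inside the `k`-th window leaves `assocExpr μ η a k` unchanged. -/
theorem assocExpr_comp_swap
    (hsymm : ∀ (σ : Equiv.Perm (Fin (m + 1))) (a : Fin (m + 1) → A), μ (a ∘ σ) = μ a)
    (a : Fin (2 * m + 1) → A) (k : Fin (m + 1)) (p : Fin (2 * m))
    (hkp : (k : ℕ) ≤ p) (hpk : (p : ℕ) + 1 ≤ k + m) :
    assocExpr μ η (a ∘ Equiv.swap p.castSucc p.succ) k = assocExpr μ η a k := by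
  unfold assocExpr
  congr 1
  funext j
  split_ifs with h h'
  · rw [Function.comp_apply, Equiv.swap_apply_of_ne_of_ne] <;>
      simp only [ne_eq, Fin.ext_iff, Fin.val_castSucc, Fin.val_succ] <;> omega
  · refine Eq.trans ?_ (hsymm (Equiv.swap ⟨p - k, by omega⟩ ⟨p + 1 - k, by omega⟩) _)
    congr 1
    funext l
    simp only [Function.comp_apply, Equiv.swap_apply_def, Fin.ext_iff, Fin.val_castSucc,
      Fin.val_succ]
    congr 1
    ext
    split_ifs <;> simp only [Fin.val_castSucc, Fin.val_succ] <;> omega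
  · rw [Function.comp_apply, Equiv.swap_apply_of_ne_of_ne] <;>
      simp only [ne_eq, Fin.ext_iff, Fin.val_castSucc, Fin.val_succ] <;> omega

/-- The common value of the Hom-associativity chain is symmetric in all `2 * m + 1` arguments. -/
theorem assocExpr_comp_perm (hm : 1 ≤ m)
    (hsymm : ∀ (σ : Equiv.Perm (Fin (m + 1))) (a : Fin (m + 1) → A), μ (a ∘ σ) = μ a)
    (hassoc : ∀ (a : Fin (2 * m + 1) → A) (k k' : Fin (m + 1)),
      assocExpr μ η a k = assocExpr μ η a k')
    (σ : Equiv.Perm (Fin (2 * m + 1))) (a : Fin (2 * m + 1) → A) (k : Fin (m + 1)) :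
    assocExpr μ η (a ∘ σ) k = assocExpr μ η a k := by
  have hσ : σ ∈ Submonoid.closure
      (Set.range fun i : Fin (2 * m) => Equiv.swap i.castSucc i.succ) := by
    rw [Equiv.Perm.mclosure_swap_castSucc_succ]
    exact Submonoid.mem_top σ
  induction hσ using Submonoid.closure_induction generalizing a with
  | mem τ hτ =>
    obtain ⟨p, rfl⟩ := hτ
    have hp := p.2
    let w : Fin (m + 1) := ⟨min p m, by omega⟩
    rw [hassoc _ k w, hassoc a k w]
    exact assocExpr_comp_swap hsymm a w p (by simp [w]) (by simp only [w]; omega)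
  | one => rfl
  | mul τ ρ _ _ ihτ ihρ =>
    rw [Equiv.Perm.coe_mul, ← Function.comp_assoc, ihρ, ihτ]

/-- In `μ(η(a), μ(b))` the roles of the arguments may be exchanged so that `a` and `b i` are
multiplied first. -/
theorem mul_snoc_twist_eq (hm : 1 ≤ m)
    (hsymm : ∀ (σ : Equiv.Perm (Fin (m + 1))) (a : Fin (m + 1) → A), μ (a ∘ σ) = μ a)
    (hassoc : ∀ (a : Fin (2 * m + 1) → A) (k k' : Fin (m + 1)),
      assocExpr μ η a k = assocExpr μ η a k')
    (a : Fin m → A) (b : Fin (m + 1) → A) (i : Fin (m + 1)) :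
    μ (Fin.snoc (fun i => η i (a i)) (μ b)) =
      μ (fun j =>
        if h : (j : ℕ) < (i : ℕ) then η ⟨(j : ℕ), by have := i.2; omega⟩ (b j)
        else if h' : (j : ℕ) = (i : ℕ) then μ (Fin.snoc a (b i))
        else η ⟨(j : ℕ) - 1, by have := j.2; omega⟩ (b j)) := by
  have hi := i.2
  let c : Fin (2 * m + 1) → A := fun p =>
    if h : (p : ℕ) < m then a ⟨p, h⟩ else b ⟨p - m, by omega⟩
  let f : Fin (2 * m + 1) → Fin (2 * m + 1) := fun p =>
    if h : (p : ℕ) < i then ⟨p + m, by omega⟩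
    else if (p : ℕ) < i + m then ⟨p - i, by omega⟩ else p
  have hf : Function.Injective f := by
    intro p q hpq
    simp only [f] at hpq
    split_ifs at hpq <;> simp only [Fin.ext_iff] at hpq ⊢ <;> omega
  let σ : Equiv.Perm (Fin (2 * m + 1)) :=
    Equiv.ofBijective f (Finite.injective_iff_bijective.mp hf)
  have hl : μ (Fin.snoc (fun i => η i (a i)) (μ b)) = assocExpr μ η c (Fin.last m) := by
    unfold assocExpr
    congr 1
    funext j
    cases j using Fin.lastCases with
    | last => simp [c]
    | cast j => simp [c]
  have hr : assocExpr μ η (c ∘ σ) i = μ (fun j =>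
        if h : (j : ℕ) < (i : ℕ) then η ⟨(j : ℕ), by have := i.2; omega⟩ (b j)
        else if h' : (j : ℕ) = (i : ℕ) then μ (Fin.snoc a (b i))
        else η ⟨(j : ℕ) - 1, by have := j.2; omega⟩ (b j)) := by
    unfold assocExpr
    congr 1
    funext j
    split_ifs with h h'
    · simp [c, σ, f, h]
    · congr 1
      funext l
      cases l using Fin.lastCases with
      | last => simp [c, σ, f]
      | cast l => simp [c, σ, f]
    · have h1 : ¬ (j : ℕ) + m < i := by omega
      simp [c, σ, f, h1, h]
  rw [hl, ← hr, assocExpr_comp_perm hm hsymm hassoc, hassoc]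

end TotallyHomAssociative

/-- The Hom-Nambu identity on `A ⊗ N` only has to be checked on pure tensors. -/
theorem homNambu_of_tmul {K A N : Type*} [Field K] [AddCommGroup A] [Module K A]
    [AddCommGroup N] [Module K N] {m : ℕ}
    (br : MultilinearMap K (fun _ : Fin (m + 1) => A ⊗[K] N) (A ⊗[K] N))
    (ζ : Fin m → (A ⊗[K] N →ₗ[K] A ⊗[K] N))
    (h : ∀ (a : Fin m → A) (x : Fin m → N) (b : Fin (m + 1) → A) (y : Fin (m + 1) → N),
      br (Fin.snoc (fun i => ζ i (a i ⊗ₜ x i)) (br fun i => b i ⊗ₜ y i)) =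
        ∑ i : Fin (m + 1), br (fun j =>
          if h : (j : ℕ) < (i : ℕ) then ζ ⟨(j : ℕ), by have := i.2; omega⟩ (b j ⊗ₜ y j)
          else if h' : (j : ℕ) = (i : ℕ) then br (Fin.snoc (fun i => a i ⊗ₜ x i) (b i ⊗ₜ y i))
          else ζ ⟨(j : ℕ) - 1, by have := j.2; omega⟩ (b j ⊗ₜ y j))) :
    HomNambu br ζ := by
  intro u v
  -- the identity in `v` for fixed `u`
  let L : MultilinearMap K (fun _ : Fin (m + 1) => A ⊗[K] N) (A ⊗[K] N) :=
    (br.curryRight fun i => ζ i (u i)).compMultilinearMap br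
  let T (i j : Fin (m + 1)) : A ⊗[K] N →ₗ[K] A ⊗[K] N :=
    if h : (j : ℕ) < (i : ℕ) then ζ ⟨(j : ℕ), by have := i.2; omega⟩
    else if h' : (j : ℕ) = (i : ℕ) then br.curryRight u
    else ζ ⟨(j : ℕ) - 1, by have := j.2; omega⟩
  have hT (i : Fin (m + 1)) (v : Fin (m + 1) → A ⊗[K] N) :
      br (fun j => T i j (v j)) = br (fun j =>
        if h : (j : ℕ) < (i : ℕ) then ζ ⟨(j : ℕ), by have := i.2; omega⟩ (v j)
        else if h' : (j : ℕ) = (i : ℕ) then br (Fin.snoc u (v i))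
        else ζ ⟨(j : ℕ) - 1, by have := j.2; omega⟩ (v j)) := by
    congr 1
    funext j
    simp only [T]
    split_ifs with h h'
    · rfl
    · rw [Fin.ext h']; rfl
    · rfl
  have hL : L = ∑ i, br.compLinearMap (T i) := by
    refine MultilinearMap.ext_tmul fun b y => ?_
    simp only [sum_apply, MultilinearMap.compLinearMap_apply, hT]
    change br (Fin.snoc (fun i => ζ i (u i)) (br fun i => b i ⊗ₜ y i)) = _
    clear hT T L v
    -- the identity in `u` for fixed pure `v`
    let L' : MultilinearMap K (fun _ : Fin m => A ⊗[K] N) (A ⊗[K] N) :=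
      (LinearMap.applyₗ (br fun i => b i ⊗ₜ y i)).compMultilinearMap
        (br.curryRight.compLinearMap ζ)
    let w (i j : Fin (m + 1)) : A ⊗[K] N :=
      if h : (j : ℕ) < (i : ℕ) then ζ ⟨(j : ℕ), by have := i.2; omega⟩ (b j ⊗ₜ y j)
      else if h' : (j : ℕ) = (i : ℕ) then 0
      else ζ ⟨(j : ℕ) - 1, by have := j.2; omega⟩ (b j ⊗ₜ y j)
    let R' (i : Fin (m + 1)) : MultilinearMap K (fun _ : Fin m => A ⊗[K] N) (A ⊗[K] N) :=
      (br.toLinearMap (w i) i ∘ₗ LinearMap.applyₗ (b i ⊗ₜ y i)).compMultilinearMap br.curryRight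
    have hR' (i : Fin (m + 1)) (u : Fin m → A ⊗[K] N) : R' i u = br (fun j =>
          if h : (j : ℕ) < (i : ℕ) then ζ ⟨(j : ℕ), by have := i.2; omega⟩ (b j ⊗ₜ y j)
          else if h' : (j : ℕ) = (i : ℕ) then br (Fin.snoc u (b i ⊗ₜ y i))
          else ζ ⟨(j : ℕ) - 1, by have := j.2; omega⟩ (b j ⊗ₜ y j)) := by
      change br (Function.update (w i) i (br (Fin.snoc u (b i ⊗ₜ y i)))) = _
      congr 1
      funext j
      by_cases hj : j = i
      · subst hj; simp
      · have hj' : (j : ℕ) ≠ i := fun h => hj (Fin.ext h)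
        simp [Function.update_of_ne hj, w, hj']
    have hL' : L' = ∑ i, R' i := by
      refine MultilinearMap.ext_tmul fun a x => ?_
      simp only [sum_apply, hR']
      exact h a x b y
    have := congrArg (fun f => f u) hL'
    simp only [sum_apply, hR'] at this
    exact this
  have := congrArg (fun f => f v) hL
  simp only [sum_apply, MultilinearMap.compLinearMap_apply, hT] at this
  exact this

/-- The tensor product of a Hom-quadratic symmetric `n`-ary totally
Hom-associative algebra `(A, μ, η, B_A, β_A)` with a Hom-quadratic `n`-ary Hom-Nambu
algebra `(N, brN, α, B_N, β_N)` is a Hom-quadratic `n`-ary Hom-Nambu algebra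
`(A⊗N, brT, ζ, B̃, ω)` with `ζᵢ = ηᵢ⊗αᵢ`, `B̃(a⊗x,b⊗y) = B_A(a,b)·B_N(x,y)` and
`ω(a⊗x) = β_A(a)⊗β_N(x)`. -/
theorem tensorProduct_hom_quadratic_homNambu
    {K : Type*} [Field K] [CharZero K]
    {A : Type*} [AddCommGroup A] [Module K A]
    {N : Type*} [AddCommGroup N] [Module K N]
    {m : ℕ} (hm : 1 ≤ m)
    (μ : MultilinearMap K (fun _ : Fin (m + 1) => A) A)
    (η : Fin m → (A →ₗ[K] A))
    (hsymm : ∀ (σ : Equiv.Perm (Fin (m + 1))) (a : Fin (m + 1) → A), μ (a ∘ σ) = μ a)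
    (hassoc : ∀ (a : Fin (2 * m + 1) → A) (k k' : Fin (m + 1)),
      assocExpr (K := K) (⇑μ) η a k = assocExpr (K := K) (⇑μ) η a k')
    (BA : A →ₗ[K] A →ₗ[K] K) (βA : A →ₗ[K] A)
    (hBAsymm : ∀ a b : A, BA a b = BA b a)
    (hBAnondeg : ∀ a : A, (∀ b : A, BA a b = 0) → a = 0)
    (hBAη : ∀ (i : Fin m) (a b : A), BA (η i a) b = BA a (η i b))
    (hBAinv : ∀ (a : Fin m → A) (b c : A),
      BA (μ (Fin.snoc a b)) (βA c) = BA (βA b) (μ (Fin.snoc a c)))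
    (brN : MultilinearMap K (fun _ : Fin (m + 1) => N) N)
    (α : Fin m → (N →ₗ[K] N)) (BN : N →ₗ[K] N →ₗ[K] K) (βN : N →ₗ[K] N)
    (hN : HomNambu (K := K) (⇑brN) α)
    (hBNsymm : ∀ x y : N, BN x y = BN y x)
    (hBNnondeg : ∀ x : N, (∀ y : N, BN x y = 0) → x = 0)
    (hBNα : ∀ (i : Fin m) (x y : N), BN (α i x) y = BN x (α i y))
    (hBNinv : ∀ (x : Fin m → N) (y z : N),
      BN (brN (Fin.snoc x y)) (βN z) + BN (βN y) (brN (Fin.snoc x z)) = 0)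
    (brT : MultilinearMap K (fun _ : Fin (m + 1) => A ⊗[K] N) (A ⊗[K] N))
    (hpure : ∀ (a : Fin (m + 1) → A) (x : Fin (m + 1) → N),
      brT (fun i => a i ⊗ₜ[K] x i) = μ a ⊗ₜ[K] brN x)
    (Bt : (A ⊗[K] N) →ₗ[K] (A ⊗[K] N) →ₗ[K] K)
    (hBtpure : ∀ (a b : A) (x y : N),
      Bt (a ⊗ₜ[K] x) (b ⊗ₜ[K] y) = BA a b * BN x y) :
    -- `(A⊗N, brT, ζ)` is a Hom-Nambu algebra
    HomNambu (K := K) (⇑brT) (fun i => TensorProduct.map (η i) (α i)) ∧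
    -- `B̃` is symmetric
    (∀ t s : A ⊗[K] N, Bt t s = Bt s t) ∧
    -- `B̃` is nondegenerate
    (∀ t : A ⊗[K] N, (∀ s : A ⊗[K] N, Bt t s = 0) → t = 0) ∧
    -- `B̃` is compatible with the twist maps `ζᵢ`
    (∀ (i : Fin m) (t s : A ⊗[K] N),
      Bt (TensorProduct.map (η i) (α i) t) s = Bt t (TensorProduct.map (η i) (α i) s)) ∧
    -- `ω`-invariance of `B̃`
    (∀ (u : Fin m → A ⊗[K] N) (v w : A ⊗[K] N),
      Bt (brT (Fin.snoc u v)) (TensorProduct.map βA βN w) +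
        Bt (TensorProduct.map βA βN v) (brT (Fin.snoc u w)) = 0) := by
  refine ⟨homNambu_of_tmul brT _ fun a x b y => ?_, fun t s => ?_,
    TensorProduct.eq_zero_of_forall_bilin_tmul_eq_zero hBAnondeg hBNnondeg hBtpure,
    fun i t s => ?_, fun u v w => ?_⟩
  · simp only [TensorProduct.map_tmul, Fin.snoc_tmul, hpure]
    rw [hN x y, TensorProduct.tmul_sum]
    refine Finset.sum_congr rfl fun i _ => ?_
    rw [mul_snoc_twist_eq hm hsymm hassoc a b i, ← hpure]
    congr 1
    funext j
    split_ifs <;> rfl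
  · induction t with
    | zero => simp
    | add t t' iht iht' => simp only [map_add, LinearMap.add_apply, iht, iht']
    | tmul a x =>
      induction s with
      | zero => simp
      | add s s' ihs ihs' => simp only [map_add, LinearMap.add_apply, ihs, ihs']
      | tmul b y => rw [hBtpure, hBtpure, hBAsymm, hBNsymm]
  · induction t with
    | zero => simp
    | add t t' iht iht' => simp only [map_add, LinearMap.add_apply, iht, iht']
    | tmul a x =>
      induction s with
      | zero => simp
      | add s s' ihs ihs' => simp only [map_add, ihs, ihs']
      | tmul b y => simp only [TensorProduct.map_tmul, hBtpure, hBAη, hBNα]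
  · let F (v w : A ⊗[K] N) : MultilinearMap K (fun _ : Fin m => A ⊗[K] N) K :=
      (Bt.flip (TensorProduct.map βA βN w) ∘ₗ LinearMap.applyₗ v).compMultilinearMap
          brT.curryRight +
        (Bt (TensorProduct.map βA βN v) ∘ₗ LinearMap.applyₗ w).compMultilinearMap brT.curryRight
    have hF : F v w = 0 := by
      refine MultilinearMap.ext_tmul fun a x => ?_
      change Bt (brT.curryRight _ v) (TensorProduct.map βA βN w) +
        Bt (TensorProduct.map βA βN v) (brT.curryRight _ w) = 0
      induction v with
      | zero => simp only [map_zero, LinearMap.zero_apply, add_zero]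
      | add v v' ihv ihv' =>
        simp only [map_add, LinearMap.add_apply]
        rw [add_add_add_comm, ihv, ihv', add_zero]
      | tmul b y =>
        induction w with
        | zero => simp only [map_zero, add_zero]
        | add w w' ihw ihw' =>
          simp only [map_add]
          rw [add_add_add_comm, ihw, ihw', add_zero]
        | tmul c z =>
          simp only [MultilinearMap.curryRight_apply, Fin.snoc_tmul, hpure, TensorProduct.map_tmul,
            hBtpure]
          rw [hBAinv, ← mul_add, hBNinv, mul_zero]
    exact congrArg (fun f => f u) hF
end

section
/- Let (N, [·,...,·], B) be a quadratic n-ary Nambu-Lie algebra and θ ∈ Cent_S(N) invertible, i.e. θ is an invertible element of the centroid with B(θ(x),y) = B(x,θ(y)). Fix l ∈ {1,...,n} and let {x_1,...,x_n}_l = [θ(x_1),...,θ(x_l), x_{l+1},...,x_n]. Define B_θ(x,y) = B(θ(x),y). Then (N, {·,...,·}_l, (θ,...,θ), B_θ) is a quadratic n-ary Hom-Nambu-Lie algebra: B_θ is a nondegenerate symmetric bilinear form, B_θ(θ(x),y) = B_θ(x,θ(y)), and B_θ({x_1,...,x_{n-1},y}_l, z) + B_θ(y, {x_1,...,x_{n-1},z}_l)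 = 0 for all x_i, y, z ∈ N. -/
/-- For a skew-symmetric bracket, an element of the centroid can be moved into any argument. -/
theorem centroid_apply_update {K : Type*} [Field K] {N : Type*} [AddCommGroup N] [Module K N]
    {m : ℕ} (br : MultilinearMap K (fun _ : Fin (m + 1) => N) N)
    (hskew : ∀ (σ : Equiv.Perm (Fin (m + 1))) (x : Fin (m + 1) → N),
      br (x ∘ σ) = (Equiv.Perm.sign σ : ℤ) • br x)
    (θ : N →ₗ[K] N)
    (hθ : ∀ x : Fin (m + 1) → N, θ (br x) = br (Function.update x 0 (θ (x 0))))
    (i : Fin (m + 1)) (x : Fin (m + 1) → N) :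
    θ (br x) = br (Function.update x i (θ (x i))) := by
  have hcomp : Function.update (x ∘ Equiv.swap 0 i) 0 (θ ((x ∘ Equiv.swap 0 i) 0)) =
      Function.update x i (θ (x i)) ∘ Equiv.swap 0 i := by
    rw [Function.update_comp_equiv]
    simp
  have h := hθ (x ∘ Equiv.swap 0 i)
  rw [hcomp, hskew, hskew, map_zsmul] at h
  rcases Int.units_eq_one_or (Equiv.Perm.sign (Equiv.swap 0 i)) with hs | hs <;>
    simpa [hs] using h

/-- Powers of a centroid element applied to the arguments come out of the bracket. -/
theorem centroid_pow_apply {K : Type*} [Field K] {N : Type*} [AddCommGroup N] [Module K N]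
    {ι : Type*} [Fintype ι] [DecidableEq ι] (br : MultilinearMap K (fun _ : ι => N) N)
    (θ : N →ₗ[K] N)
    (hθ : ∀ (i : ι) (x : ι → N), θ (br x) = br (Function.update x i (θ (x i))))
    (k : ι → ℕ) (x : ι → N) :
    br (fun i => (θ ^ k i) (x i)) = (θ ^ ∑ i, k i) (br x) := by
  have hpow : ∀ (r : ℕ) (i : ι) (x : ι → N),
      (θ ^ r) (br x) = br (Function.update x i ((θ ^ r) (x i))) := by
    intro r i x
    induction r with
    | zero => simp
    | succ r ih => rw [pow_succ', Module.End.mul_apply, ih, hθ i]; simp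
  have key : ∀ s : Finset ι,
      br (fun i => if i ∈ s then (θ ^ k i) (x i) else x i) = (θ ^ ∑ i ∈ s, k i) (br x) := by
    intro s
    induction s using Finset.induction_on with
    | empty => simp
    | insert a s ha ih =>
      rw [Finset.sum_insert ha, pow_add, Module.End.mul_apply, ← ih, hpow _ a]
      congr 1
      ext j
      rcases eq_or_ne j a with rfl | hj
      · simp [ha]
      · simp [hj]
  simpa using key Finset.univ

/-- Let `(N, br, B)` be a quadratic `n`-ary Nambu-Lie algebra and
`θ ∈ Cent_S(N)` invertible.  For `l ∈ {1,…,n}`, with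
`{x₁,…,xₙ}_l = [θ(x₁),…,θ(x_l), x_{l+1},…,xₙ]` and `B_θ(x,y) = B(θ(x),y)`, the data
`(N, {·,…,·}_l, (θ,…,θ), B_θ)` is a quadratic `n`-ary Hom-Nambu-Lie algebra. -/
theorem centroid_quadratic_homNambuLie
    {K : Type*} [Field K] [CharZero K] {N : Type*} [AddCommGroup N] [Module K N]
    {m : ℕ} (hm : 1 ≤ m)
    (br : MultilinearMap K (fun _ : Fin (m + 1) => N) N)
    (hNambu : HomNambu (K := K) (⇑br) (fun _ => LinearMap.id))
    (hskew : ∀ (σ : Equiv.Perm (Fin (m + 1))) (x : Fin (m + 1) → N),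
      br (x ∘ σ) = (Equiv.Perm.sign σ : ℤ) • br x)
    (B : N →ₗ[K] N →ₗ[K] K)
    (hBsymm : ∀ x y : N, B x y = B y x)
    (hBnondeg : ∀ x : N, (∀ y : N, B x y = 0) → x = 0)
    (hBinv : ∀ (x : Fin m → N) (y z : N),
      B (br (Fin.snoc x y)) z + B y (br (Fin.snoc x z)) = 0)
    (θ : N →ₗ[K] N)
    (hθ : ∀ x : Fin (m + 1) → N,
      θ (br x) = br (Function.update x 0 (θ (x 0))))
    (hθB : ∀ x y : N, B (θ x) y = B x (θ y))
    (hθbij : Function.Bijective θ)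
    (l : ℕ) (hl1 : 1 ≤ l) (hl2 : l ≤ m + 1) :
    -- skew-symmetry of `{·,…,·}_l`
    (∀ (σ : Equiv.Perm (Fin (m + 1))) (x : Fin (m + 1) → N),
      br (fun i => if (i : ℕ) < l then θ (x (σ i)) else x (σ i)) =
        (Equiv.Perm.sign σ : ℤ) • br (fun i => if (i : ℕ) < l then θ (x i) else x i)) ∧
    -- Hom-Nambu identity with all twist maps equal to `θ`
    HomNambu (K := K)
      (fun x => br (fun i => if (i : ℕ) < l then θ (x i) else x i))
      (fun _ => θ) ∧
    -- `B_θ` is symmetric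
    (∀ x y : N, B (θ x) y = B (θ y) x) ∧
    -- `B_θ` is nondegenerate
    (∀ x : N, (∀ y : N, B (θ x) y = 0) → x = 0) ∧
    -- `θ` is symmetric with respect to `B_θ`
    (∀ x y : N, B (θ (θ x)) y = B (θ x) (θ y)) ∧
    -- invariance of `B_θ` for `{·,…,·}_l`
    (∀ (x : Fin m → N) (y z : N),
      B (θ (br (fun i => if (i : ℕ) < l then θ ((Fin.snoc x y : Fin (m + 1) → N) i) else (Fin.snoc x y : Fin (m + 1) → N) i))) z +
        B (θ y) (br (fun i => if (i : ℕ) < l then θ ((Fin.snoc x z : Fin (m + 1) → N) i) else (Fin.snoc x z : Fin (m + 1) → N) i)) = 0) := by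
  have hpow := centroid_pow_apply br θ (centroid_apply_update br hskew θ hθ)
  obtain ⟨p, hp⟩ : ∃ p : ℕ, ∀ x : Fin (m + 1) → N,
      br (fun i => if (i : ℕ) < l then θ (x i) else x i) = (θ ^ p) (br x) := by
    refine ⟨∑ i : Fin (m + 1), if (i : ℕ) < l then 1 else 0, fun x => ?_⟩
    rw [← hpow (fun i => if (i : ℕ) < l then 1 else 0) x]
    congr 1
    ext i
    split_ifs <;> simp
  have hlast : ∀ (r : ℕ) (x : Fin m → N) (y : N),
      br (Fin.snoc x ((θ ^ r) y)) = (θ ^ r) (br (Fin.snoc x y)) := by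
    intro r x y
    have h := hpow (Fin.snoc (fun _ => 0) r) (Fin.snoc x y)
    simp only [Fin.sum_univ_castSucc, Fin.snoc_castSucc, Fin.snoc_last, Finset.sum_const_zero,
      zero_add] at h
    rw [← h]
    congr 1
    ext j
    refine Fin.lastCases ?_ (fun j => ?_) j <;> simp
  have hBpow : ∀ (r : ℕ) (x y : N), B ((θ ^ r) x) y = B x ((θ ^ r) y) := by
    intro r
    induction r with
    | zero => simp
    | succ r ih =>
      intro x y
      rw [pow_succ, Module.End.mul_apply, ih, hθB, ← Module.End.mul_apply, ← pow_succ', pow_succ]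
  refine ⟨fun σ x => ?_, fun x y => ?_, fun x y => ?_, fun x h => ?_, fun x y => hθB _ _,
    fun x y z => ?_⟩
  · rw [hp x, ← map_zsmul, ← hskew]
    exact hp (x ∘ σ)
  · simp only [hp]
    have hx : br (Fin.snoc (fun i => θ (x i)) ((θ ^ p) (br y))) =
        (θ ^ (m + p)) (br (Fin.snoc x (br y))) := by
      have h := hpow (Fin.snoc (fun _ => 1) p) (Fin.snoc x (br y))
      simp only [Fin.sum_univ_castSucc, Fin.snoc_castSucc, Fin.snoc_last, Finset.sum_const,
        Finset.card_univ, Fintype.card_fin, smul_eq_mul, mul_one] at h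
      rw [← h]
      congr 1
      ext j
      refine Fin.lastCases ?_ (fun j => ?_) j <;> simp
    have hN := hNambu x y
    simp only [LinearMap.id_coe, id_eq] at hN
    rw [hx, hN, map_sum, map_sum]
    refine Finset.sum_congr rfl fun i _ => congrArg _ ?_
    have hsum : ∑ j, (if j = i then p else 1) = m + p := by
      rw [← Finset.add_sum_erase _ _ (Finset.mem_univ i), if_pos rfl,
        Finset.sum_congr rfl fun j hj => if_neg (Finset.ne_of_mem_erase hj)]
      simp [add_comm]
    rw [← hsum, ← hpow]
    congr 1
    ext j
    rcases eq_or_ne j i with rfl | hj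
    · simp
    · have hj' : (j : ℕ) ≠ i := fun h => hj (Fin.ext h)
      simp [hj, hj']
  · rw [hθB, hBsymm]
  · exact hθbij.1 ((hBnondeg _ h).trans (map_zero θ).symm)
  · rw [hp, hp, ← Module.End.mul_apply, ← pow_succ', ← hlast, ← hBpow, ← Module.End.mul_apply,
      ← pow_succ]
    exact hBinv _ _ _
end
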